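/- arXiv:2206.02744 — 4 statements merged into one kernel-verified Lean document; each statement's English description precedes it below -/
import Mathlib

section
/- Let α : A → B be a surjective homomorphism of K-algebras. Then α is classically-central (i.e. a*a' = a'*a for all a, a' ∈ A with α(a') = 0) if and only if α is algebraically-central, meaning: for every K-algebra C and every pair of K-algebra homomorphisms u, v : C → A with α∘u = α∘v, one has u(x) = v(x) for every x in the two-sided ideal R(C) of C generated by all commutators c*c' - c'*c. -/
universe u

/-- The two-sided ideal `R(C)` of a non-unital `K`-algebra `C` generated by all
commutators `c * c' - c' * c`. -/
def commutatorIdeal (C : Type*) [NonUnitalRing C] : TwoSidedIdeal C :=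
  TwoSidedIdeal.span {y : C | ∃ c c' : C, y = c * c' - c' * c}

/-- A surjective homomorphism of `K`-algebras is classically-central iff it is
algebraically-central. -/
theorem classicallyCentral_iff_algebraicallyCentral
    {K : Type*} [CommRing K] {A : Type u} {B : Type*}
    [NonUnitalRing A] [Module K A] [SMulCommClass K A A] [IsScalarTower K A A]
    [NonUnitalRing B] [Module K B] [SMulCommClass K B B] [IsScalarTower K B B]
    (α : A →ₙₐ[K] B) (hα : Function.Surjective α) :
    (∀ a a' : A, α a' = 0 → a * a' = a' * a) ↔
      (∀ (C : Type u) [NonUnitalRing C] [Module K C] [SMulCommClass K C C]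
        [IsScalarTower K C C] (u v : C →ₙₐ[K] A),
          α.comp u = α.comp v → ∀ x ∈ commutatorIdeal C, u x = v x) := by
  constructor
  · intro h C _ _ _ _ u v huv x hx
    have hk : ∀ c, α (u c - v c) = 0 := by
      intro c
      have := DFunLike.congr_fun huv c
      simp only [NonUnitalAlgHom.comp_apply] at this
      rw [map_sub, this, sub_self]
    have hcomm : ∀ k : A, α k = 0 → ∀ a b : A, k * (a * b - b * a) = 0 := by
      intro k hk a b
      have h1 : α (k * a) = 0 := by rw [map_mul, hk, zero_mul]
      have h2 := h b (k * a) h1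
      rw [mul_sub, ← mul_assoc, ← mul_assoc, ← h2, ← mul_assoc, h b k hk, sub_self]
    let I : TwoSidedIdeal C := TwoSidedIdeal.mk'
      {x : C | u x = v x ∧ ∀ k : A, α k = 0 → k * u x = 0}
      (by simp)
      (by
        rintro x y ⟨h1, h2⟩ ⟨h3, h4⟩
        refine ⟨by rw [map_add, map_add, h1, h3], fun k hk => ?_⟩
        rw [map_add, mul_add, h2 k hk, h4 k hk, add_zero])
      (by
        rintro x ⟨h1, h2⟩
        refine ⟨by rw [map_neg, map_neg, h1], fun k hk => ?_⟩
        rw [map_neg, mul_neg, h2 k hk, neg_zero])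
      (by
        rintro y x ⟨h1, h2⟩
        refine ⟨?_, fun k hk => ?_⟩
        · rw [map_mul, map_mul, ← h1, ← sub_eq_zero, ← sub_mul]
          exact h2 _ (hk y)
        · rw [map_mul, ← mul_assoc]
          exact h2 _ (by rw [map_mul, hk, zero_mul]))
      (by
        rintro x y ⟨h1, h2⟩
        refine ⟨?_, fun k hk => ?_⟩
        · rw [map_mul, map_mul, ← h1, ← sub_eq_zero, ← mul_sub, h _ _ (hk y)]
          exact h2 _ (hk y)
        · rw [map_mul, ← mul_assoc, h2 k hk, zero_mul])
    have hle : commutatorIdeal C ≤ I := by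
      refine TwoSidedIdeal.span_le.2 ?_
      rintro _ ⟨c, c', rfl⟩
      refine (TwoSidedIdeal.mem_mk' _ _ _ _ _ _ _).2 ⟨?_, fun k hk => ?_⟩
      · have e1 := h (u c) _ (hk c')
        have e2 := h (v c') _ (hk c)
        simp only [map_sub, map_mul]
        rw [mul_sub, sub_mul] at e1 e2
        have e3 : u c * u c' - u c' * u c = u c * v c' - v c' * u c := by
          rw [sub_eq_sub_iff_sub_eq_sub]; exact e1
        have e4 : u c * v c' - v c' * u c = v c * v c' - v c' * v c := by
          rw [sub_eq_sub_iff_sub_eq_sub]; exact e2.symm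
        exact e3.trans e4
      · simp only [map_sub, map_mul]
        exact hcomm k hk _ _
    exact ((TwoSidedIdeal.mem_mk' _ _ _ _ _ _ _).1 (hle hx)).1
  · intro h a a' ha'
    let S : NonUnitalSubalgebra K (A × A) :=
      { carrier := {p | α p.1 = α p.2}
        add_mem' := by
          intro p q hp hq
          simp only [Set.mem_setOf_eq] at *
          simp [hp, hq]
        zero_mem' := by simp
        mul_mem' := by
          intro p q hp hq
          simp only [Set.mem_setOf_eq] at *
          simp [hp, hq]
        smul_mem' := by
          intro c p hp
          simp only [Set.mem_setOf_eq] at *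
          simp [hp] }
    let u : S →ₙₐ[K] A := (NonUnitalAlgHom.fst K A A).comp (NonUnitalSubalgebraClass.subtype S)
    let v : S →ₙₐ[K] A := (NonUnitalAlgHom.snd K A A).comp (NonUnitalSubalgebraClass.subtype S)
    let p : S := ⟨(a, a), rfl⟩
    let q : S := ⟨(a', 0), show α a' = α 0 by rw [ha', map_zero]⟩
    have key := h S u v (by ext x; exact x.2) (p * q - q * p)
      (TwoSidedIdeal.subset_span ⟨p, q, rfl⟩)
    have key2 : a * a' - a' * a = a * 0 - 0 * a := key
    rw [mul_zero, zero_mul, sub_zero] at key2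
    exact sub_eq_zero.1 key2
end

section
/- Let f : A → A', α : A → B, g : B → B', α' : A' → B' be K-algebra homomorphisms with α'∘f = g∘α, and suppose the square is a pullback (for every a' ∈ A' and b ∈ B with α'(a') = g(b) there exists a unique a ∈ A with f(a) = a' and α(a) = b). If α' is surjective and classically-central, then α is surjective and classically-central. -/
/-- If a commutative square of `K`-algebra homomorphisms is a pullback and `α'` is a
surjective classically-central homomorphism, then so is `α`. -/
theorem classicallyCentral_of_pullback
    {K : Type*} [CommRing K] {A B A' B' : Type*}
    [NonUnitalRing A] [Module K A] [SMulCommClass K A A] [IsScalarTower K A A]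
    [NonUnitalRing B] [Module K B] [SMulCommClass K B B] [IsScalarTower K B B]
    [NonUnitalRing A'] [Module K A'] [SMulCommClass K A' A'] [IsScalarTower K A' A']
    [NonUnitalRing B'] [Module K B'] [SMulCommClass K B' B'] [IsScalarTower K B' B']
    (f : A →ₙₐ[K] A') (α : A →ₙₐ[K] B) (g : B →ₙₐ[K] B') (α' : A' →ₙₐ[K] B')
    (hsquare : ∀ a : A, α' (f a) = g (α a))
    (hpb : ∀ (a' : A') (b : B), α' a' = g b → ∃! a : A, f a = a' ∧ α a = b)
    (hα'surj : Function.Surjective α')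
    (hα'cc : ∀ a a' : A', α' a' = 0 → a * a' = a' * a) :
    Function.Surjective α ∧ (∀ a a' : A, α a' = 0 → a * a' = a' * a) := by
  constructor
  · intro b
    obtain ⟨a', ha'⟩ := hα'surj (g b)
    obtain ⟨a, ⟨_, ha⟩, _⟩ := hpb a' b ha'
    exact ⟨a, ha⟩
  · intro a a' h
    have hf : α' (f a') = 0 := by rw [hsquare, h, map_zero]
    refine (hpb (f (a' * a)) (α (a' * a)) (hsquare _)).unique ⟨?_, ?_⟩ ⟨rfl, rfl⟩
    · rw [map_mul, map_mul, hα'cc _ _ hf]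
    · rw [map_mul, map_mul, h, mul_zero, zero_mul]
end

section
/- Let f : A → A', α : A → B, g : B → B', α' : A' → B' be K-algebra homomorphisms with α'∘f = g∘α, and suppose the square is a pullback (for every a' ∈ A' and b ∈ B with α'(a') = g(b) there exists a unique a ∈ A with f(a) = a' and α(a) = b). If α is surjective and classically-central and g is surjective, then α' is surjective and classically-central. -/
/-- If a commutative square of `K`-algebra homomorphisms is a pullback, `α` is a
surjective classically-central homomorphism and `g` is surjective, then `α'` is
surjective and classically-central. -/
theorem classicallyCentral_of_pullback_descent
    {K : Type*} [CommRing K] {A B A' B' : Type*}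
    [NonUnitalRing A] [Module K A] [SMulCommClass K A A] [IsScalarTower K A A]
    [NonUnitalRing B] [Module K B] [SMulCommClass K B B] [IsScalarTower K B B]
    [NonUnitalRing A'] [Module K A'] [SMulCommClass K A' A'] [IsScalarTower K A' A']
    [NonUnitalRing B'] [Module K B'] [SMulCommClass K B' B'] [IsScalarTower K B' B']
    (f : A →ₙₐ[K] A') (α : A →ₙₐ[K] B) (g : B →ₙₐ[K] B') (α' : A' →ₙₐ[K] B')
    (hsquare : ∀ a : A, α' (f a) = g (α a))
    (hpb : ∀ (a' : A') (b : B), α' a' = g b → ∃! a : A, f a = a' ∧ α a = b)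
    (hαsurj : Function.Surjective α)
    (hαcc : ∀ a a' : A, α a' = 0 → a * a' = a' * a)
    (hgsurj : Function.Surjective g) :
    Function.Surjective α' ∧ (∀ a a' : A', α' a' = 0 → a * a' = a' * a) := by
  refine ⟨fun b' => ?_, fun x y hy => ?_⟩
  · obtain ⟨b, rfl⟩ := hgsurj b'
    obtain ⟨a, rfl⟩ := hαsurj b
    exact ⟨f a, hsquare a⟩
  · obtain ⟨b, hb⟩ := hgsurj (α' x)
    obtain ⟨a, ⟨rfl, -⟩, -⟩ := hpb x b hb.symm
    obtain ⟨c, ⟨rfl, hc⟩, -⟩ := hpb y 0 (by rw [hy, map_zero])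
    rw [← map_mul, ← map_mul, hαcc a c hc]
end

section
/- (Concrete form of Proposition 4.2 for K-algebras.) Let (A, B, X, α, β, κ) and (A', B', X, α', β', κ') be split extensions of K-algebras with the same kernel object X, and let g : B → B' be a K-algebra homomorphism. Then the following are equivalent: (a) there exists a K-algebra homomorphism f : A → A' with f∘κ = κ', α'∘f = g∘α and f∘β = β'∘g; (b) there exists a unique such f; (c) the actions are compatible along g, i.e. for all b ∈ B and x, y ∈ X: κ(y) = β(b)*κ(x) implies κ'(y) = β'(g(b))*κ'(x), and κ(y) = κ(x)*β(b) implies κ'(y) = κ'(x)*β'(g(b)). -/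
/-- Concrete form of Proposition 4.2 for `K`-algebras: given two split extensions with
the same kernel object `X` and a homomorphism `g : B → B'`, a morphism of split
extensions `(f, g, 1_X)` exists iff it exists uniquely iff the two actions are
compatible along `g`. -/
theorem splitExtension_morphism_tfae
    {K : Type*} [CommRing K] {A B A' B' X : Type*}
    [NonUnitalRing A] [Module K A] [SMulCommClass K A A] [IsScalarTower K A A]
    [NonUnitalRing B] [Module K B] [SMulCommClass K B B] [IsScalarTower K B B]
    [NonUnitalRing A'] [Module K A'] [SMulCommClass K A' A'] [IsScalarTower K A' A']
    [NonUnitalRing B'] [Module K B'] [SMulCommClass K B' B'] [IsScalarTower K B' B']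
    [NonUnitalRing X] [Module K X] [SMulCommClass K X X] [IsScalarTower K X X]
    (κ : X →ₙₐ[K] A) (α : A →ₙₐ[K] B) (β : B →ₙₐ[K] A)
    (hβ : ∀ b : B, α (β b) = b)
    (hκinj : Function.Injective κ)
    (hκker : ∀ a : A, α a = 0 ↔ ∃ x : X, κ x = a)
    (κ' : X →ₙₐ[K] A') (α' : A' →ₙₐ[K] B') (β' : B' →ₙₐ[K] A')
    (hβ' : ∀ b : B', α' (β' b) = b)
    (hκ'inj : Function.Injective κ')
    (hκ'ker : ∀ a : A', α' a = 0 ↔ ∃ x : X, κ' x = a)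
    (g : B →ₙₐ[K] B') :
    ((∃ f : A →ₙₐ[K] A',
        (∀ x : X, f (κ x) = κ' x) ∧ (∀ a : A, α' (f a) = g (α a)) ∧
          (∀ b : B, f (β b) = β' (g b))) ↔
      (∃! f : A →ₙₐ[K] A',
        (∀ x : X, f (κ x) = κ' x) ∧ (∀ a : A, α' (f a) = g (α a)) ∧
          (∀ b : B, f (β b) = β' (g b)))) ∧
    ((∃! f : A →ₙₐ[K] A',
        (∀ x : X, f (κ x) = κ' x) ∧ (∀ a : A, α' (f a) = g (α a)) ∧
          (∀ b : B, f (β b) = β' (g b))) ↔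
      (∀ (b : B) (x y : X),
        (κ y = β b * κ x → κ' y = β' (g b) * κ' x) ∧
          (κ y = κ x * β b → κ' y = κ' x * β' (g b)))) := by
  have hdec : ∀ a : A, ∃ x : X, κ x = a - β (α a) := fun a =>
    (hκker _).1 (by rw [map_sub, hβ, sub_self])
  have huniq : (∃ f : A →ₙₐ[K] A',
        (∀ x : X, f (κ x) = κ' x) ∧ (∀ a : A, α' (f a) = g (α a)) ∧
          (∀ b : B, f (β b) = β' (g b))) →
      (∃! f : A →ₙₐ[K] A',
        (∀ x : X, f (κ x) = κ' x) ∧ (∀ a : A, α' (f a) = g (α a)) ∧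
          (∀ b : B, f (β b) = β' (g b))) := by
    rintro ⟨f, h1, h2, h3⟩
    refine ⟨f, ⟨h1, h2, h3⟩, ?_⟩
    rintro f' ⟨h1', _, h3'⟩
    ext a
    obtain ⟨x, hx⟩ := hdec a
    have ha : a = κ x + β (α a) := by rw [hx, sub_add_cancel]
    rw [ha, map_add, map_add, h1, h1', h3, h3']
  refine ⟨⟨huniq, fun h => h.exists⟩, ?_, ?_⟩
  · intro h b x y
    obtain ⟨f, h1, _, h3⟩ := h.exists
    refine ⟨fun hy => ?_, fun hy => ?_⟩
    · rw [← h1, hy, map_mul, h1, h3]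
    · rw [← h1, hy, map_mul, h1, h3]
  · intro hc
    apply huniq
    choose p hp using hdec
    have hακ : ∀ x, α (κ x) = 0 := fun x => (hκker _).2 ⟨x, rfl⟩
    have hα'κ' : ∀ x, α' (κ' x) = 0 := fun x => (hκ'ker _).2 ⟨x, rfl⟩
    have padd : ∀ a b, p (a + b) = p a + p b := fun a b => hκinj (by
      rw [map_add, hp, hp, hp, map_add, map_add]; abel)
    have psmul : ∀ (k : K) a, p (k • a) = k • p a := fun k a => hκinj (by
      rw [map_smul, hp, hp, map_smul, map_smul, smul_sub])
    have pκ : ∀ x, p (κ x) = x := fun x => hκinj (by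
      rw [hp, hακ, map_zero, sub_zero])
    have pβ : ∀ b, p (β b) = 0 := fun b => hκinj (by
      rw [hp, hβ, sub_self, map_zero])
    have pmul : ∀ a b, κ' (p (a * b)) = κ' (p a) * κ' (p b)
        + β' (g (α a)) * κ' (p b) + κ' (p a) * β' (g (α b)) := by
      intro a b
      obtain ⟨y, hy⟩ := (hκker (β (α a) * κ (p b))).1 (by rw [map_mul, hακ, mul_zero])
      obtain ⟨z, hz⟩ := (hκker (κ (p a) * β (α b))).1 (by rw [map_mul, hακ, zero_mul])
      have : p (a * b) = p a * p b + y + z := hκinj (by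
        rw [map_add, map_add, map_mul, hy, hz, hp, hp, hp, map_mul, map_mul]
        noncomm_ring)
      rw [this, map_add, map_add, map_mul, (hc _ _ _).1 hy, (hc _ _ _).2 hz]
    refine ⟨{ toFun := fun a => κ' (p a) + β' (g (α a))
              map_smul' := ?_
              map_zero' := ?_
              map_add' := ?_
              map_mul' := ?_ }, ?_, ?_, ?_⟩
    · intro k a
      simp [psmul]
    · have h0 : p 0 = 0 := by simpa using pκ 0
      simp [h0]
    · intro a b
      simp only [padd, map_add]
      abel
    · intro a b
      simp only [pmul, map_mul, add_mul, mul_add]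
      abel
    · intro x
      change κ' (p (κ x)) + β' (g (α (κ x))) = κ' x
      simp [pκ, hακ]
    · intro a
      change α' (κ' (p a) + β' (g (α a))) = g (α a)
      rw [map_add, hα'κ', hβ', zero_add]
    · intro b
      change κ' (p (β b)) + β' (g (α (β b))) = β' (g b)
      rw [pβ, hβ, map_zero, zero_add]
end
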